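/- Let f : ℝP² → ℝ be continuous. Then the homotopy significant spectrum of f equals { hs₁, hs₂, hs₃ }. -/

import Mathlib

open Set Metric Topology unitInterval

noncomputable section
open Classical

variable {B : Type*} [NormedAddCommGroup B] [NormedSpace ℝ B]

/-- There exists a continuous, odd, nonvanishing map `A → ℝ^m \ {0}`. -/
def HasOddMap (A : Set B) (m : ℕ) : Prop :=
  ∃ h : A → (Fin m → ℝ), Continuous h ∧ (∀ x, h x ≠ 0) ∧
    ∀ (x : A) (hx : -(x : B) ∈ A), h ⟨-(x : B), hx⟩ = -h x

/-- Krasnoselskii genus. -/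
def genus (A : Set B) : ℕ∞ :=
  if A = ∅ then 0 else sInf {m : ℕ∞ | ∃ k : ℕ, m = k ∧ HasOddMap A k}

/-- A set is contractible within the ambient space `Φ`. -/
def ContractibleIn {Φ : Type*} [TopologicalSpace Φ] (C : Set Φ) : Prop :=
  ∃ x₀ : Φ, ∃ H : C(↥C × ↥I, Φ),
    (∀ x : C, H (x, 0) = (x : Φ)) ∧ (∀ x : C, H (x, 1) = x₀)

/-- Lusternik–Schnirelmann subspace category (with closed covers). -/
def catLS {Φ : Type*} [TopologicalSpace Φ] (A : Set Φ) : ℕ∞ :=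
  sInf {m : ℕ∞ | ∃ k : ℕ, m = k ∧ ∃ C : Fin k → Set Φ,
    (∀ i, IsClosed (C i)) ∧ (∀ i, ContractibleIn (C i)) ∧ A ⊆ ⋃ i, C i}

/-- `X` can be brought to `Y` via a homotopy in `Φ` starting from the inclusion. -/
def BringsTo {Φ : Type*} [TopologicalSpace Φ] (X Y : Set Φ) : Prop :=
  ∃ H : C(↥X × ↥I, Φ),
    (∀ x : X, H (x, 0) = (x : Φ)) ∧ (∀ x : X, H (x, 1) ∈ Y)

/-- `a` lies in the homotopy significant spectrum of `f`. -/
def HomotopySignificant {Φ : Type*} [TopologicalSpace Φ] (f : Φ → ℝ) (a : ℝ) : Prop :=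
  ¬ BringsTo {x | f x ≤ a} {x | f x < a}

/-- `e` is a weak homotopy significant eigenvalue of `f`. -/
def WeakHomotopySignificant {Φ : Type*} [TopologicalSpace Φ] (f : Φ → ℝ) (e : ℝ) : Prop :=
  ∀ t₁ > e, ∀ t₂ < e, ¬ BringsTo {x | f x ≤ t₁} {x | f x ≤ t₂}

/-- The k-th Krasnoselskii eigenvalue of (the restriction to the unit sphere of) `f`. -/
def kr (f : B → ℝ) (k : ℕ) : EReal :=
  ⨅ A ∈ {A : Set B | A ⊆ sphere (0 : B) 1 ∧ IsClosed A ∧ A = -A ∧ (k : ℕ∞) ≤ genus A},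
    ⨆ x ∈ A, (f x : EReal)

/-- The k-th category (min-max) eigenvalue of `f`. -/
def hs {Φ : Type*} [TopologicalSpace Φ] (f : Φ → ℝ) (k : ℕ) : EReal :=
  ⨅ A ∈ {A : Set Φ | IsClosed A ∧ (k : ℕ∞) ≤ catLS A}, ⨆ x ∈ A, (f x : EReal)

/-- The antipodal setoid on the unit sphere of `B`. -/
def projSetoid (B : Type*) [NormedAddCommGroup B] [NormedSpace ℝ B] :
    Setoid ↥(sphere (0 : B) 1) where
  r x y := (x : B) = y ∨ (x : B) = -(y : B)
  iseqv := by
    constructor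
    · intro x; exact Or.inl rfl
    · rintro x y (h | h)
      · exact Or.inl h.symm
      · exact Or.inr (by rw [h, neg_neg])
    · rintro x y z (h | h) (h' | h')
      · exact Or.inl (h.trans h')
      · exact Or.inr (by rw [h, h'])
      · exact Or.inr (by rw [h, h'])
      · exact Or.inl (by rw [h, h', neg_neg])

/-- The projective space of `B`, as the quotient of the unit sphere by the antipodal map. -/
def Proj (B : Type*) [NormedAddCommGroup B] [NormedSpace ℝ B] := Quotient (projSetoid B)

instance : TopologicalSpace (Proj B) := instTopologicalSpaceQuotient


abbrev E3 := EuclideanSpace ℝ (Fin 3)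
abbrev S2 := ↥(sphere (0 : E3) 1)
abbrev P2 := Proj E3

def pr : S2 → P2 := Quotient.mk (projSetoid E3)

lemma pr_eq_iff {x y : S2} : pr x = pr y ↔ x = y ∨ x = -y := by
  have h1 : pr x = pr y ↔ ((x : E3) = y ∨ (x : E3) = -(y : E3)) :=
    Quotient.eq (r := projSetoid E3)
  rw [h1]
  simp [Subtype.ext_iff]

lemma pr_neg (x : S2) : pr (-x) = pr x := pr_eq_iff.2 (Or.inr rfl)

lemma pr_surj : Function.Surjective pr := Quotient.mk_surjective

lemma S2_ne_neg (x : S2) : x ≠ -x := by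
  intro h
  have h1 : (x : E3) = -(x : E3) := congrArg Subtype.val h
  have h2 : (x : E3) = 0 := by
    have h4 : (2 : ℝ) • (x : E3) = 0 := by
      rw [two_smul]
      nth_rewrite 2 [h1]
      simp
    exact (smul_eq_zero.1 h4).resolve_left two_ne_zero
  have h3 : ‖(x : E3)‖ = 1 := by simp
  rw [h2] at h3; simp at h3

@[reducible] def actS2 : MulAction ℤˣ S2 where
  smul u x := if u = 1 then x else -x
  one_smul x := by change (if (1 : ℤˣ) = 1 then x else -x) = x; simp
  mul_smul u v x := by
    change (if u * v = 1 then x else -x) =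
      (if u = 1 then (if v = 1 then x else -x) else -(if v = 1 then x else -x))
    rcases Int.units_eq_one_or u with rfl | rfl <;> rcases Int.units_eq_one_or v with rfl | rfl <;> simp

lemma pr_quotientMap : IsQuotientMap pr := isQuotientMap_quotient_mk'

lemma pr_qcov : @IsQuotientCoveringMap _ _ _ _ pr ℤˣ _ actS2 := by
  let _ := actS2
  have hs : ∀ (u : ℤˣ) (x : S2), u • x = if u = 1 then x else -x := fun _ _ => rfl
  have hc : ContinuousConstSMul ℤˣ S2 := by
    constructor
    intro u
    simp only [hs]
    rcases Int.units_eq_one_or u with rfl | rfl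
    · simpa using continuous_id'
    · simpa using continuous_neg
  refine { toIsQuotientMap := pr_quotientMap, toContinuousConstSMul := hc, apply_eq_iff_mem_orbit := ?_, disjoint := ?_ }
  · intro x y
    rw [pr_eq_iff]
    constructor
    · rintro (h | h)
      · exact ⟨1, by simp [h]⟩
      · exact ⟨-1, by simp [hs, h]⟩
    · rintro ⟨u, rfl⟩
      rcases Int.units_eq_one_or u with rfl | rfl
      · left; simp
      · right; simp [hs]
  · intro x
    obtain ⟨U, V, hU, hV, hxU, hxV, hd⟩ := t2_separation (S2_ne_neg x)
    refine ⟨U ∩ (fun y => -y) ⁻¹' V, Filter.inter_mem (hU.mem_nhds hxU)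
      ((hV.preimage continuous_neg).mem_nhds hxV), ?_⟩
    rintro u ⟨y, ⟨z, hz, rfl⟩, hy⟩
    rcases Int.units_eq_one_or u with rfl | rfl
    · rfl
    · exfalso
      have : (-1 : ℤˣ) • z = -z := by simp [hs]
      simp only [this] at hy
      exact Set.disjoint_left.1 hd hy.1 hz.2

lemma pr_cov : IsCoveringMap pr := by
  let _ := actS2
  exact pr_qcov.isCoveringMap

lemma pr_open : IsOpenQuotientMap pr := by
  let _ := actS2
  exact pr_qcov.isOpenQuotientMap

lemma pr_cont : Continuous pr := pr_open.continuous

instance : CompactSpace P2 := by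
  constructor
  rw [← pr_surj.range_eq]
  exact isCompact_range pr_cont

/-- odd maps of the sphere to `ℝ^k` not vanishing over `A` -/
def OM (A : Set P2) (k : ℕ) : Prop :=
  ∃ h : C(S2, Fin k → ℝ), (∀ x, h (-x) = - h x) ∧ ∀ x, pr x ∈ A → h x ≠ 0

lemma OM.mono {A B : Set P2} {k : ℕ} (h : OM B k) (hAB : A ⊆ B) : OM A k := by
  obtain ⟨g, h1, h2⟩ := h
  exact ⟨g, h1, fun x hx => h2 x (hAB hx)⟩

lemma OM.mono_k {A : Set P2} {j k : ℕ} (h : OM A j) (hjk : j ≤ k) : OM A k := by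
  obtain ⟨g, h1, h2⟩ := h
  refine ⟨⟨fun x i => if hi : (i : ℕ) < j then g x ⟨i, hi⟩ else 0, ?_⟩, ?_, ?_⟩
  · refine continuous_pi fun i => ?_
    by_cases hi : (i : ℕ) < j
    · simp only [hi, dite_true]; fun_prop
    · simp only [hi, dite_false]; fun_prop
  · intro x
    ext i
    by_cases hi : (i : ℕ) < j <;> simp [hi, h1]
  · intro x hx h0
    apply h2 x hx
    ext i
    have := congrFun h0 ⟨i, i.2.trans_le hjk⟩
    simpa using this

/-- extension of an odd map from a closed invariant set -/
lemma OM_of_partial {A : Set P2} (hA : IsClosed A) {k : ℕ} (g : (pr ⁻¹' A) → (Fin k → ℝ))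
    (hg : Continuous g) (hodd : ∀ x y : pr ⁻¹' A, (y : S2) = -(x : S2) → g y = - g x)
    (h0 : ∀ x, g x ≠ 0) : OM A k := by
  have hcl : IsClosed (pr ⁻¹' A) := hA.preimage pr_cont
  obtain ⟨G, hG⟩ := ContinuousMap.exists_restrict_eq hcl (⟨g, hg⟩ : C(pr ⁻¹' A, Fin k → ℝ))
  have hG' : ∀ (x : S2) (hx : pr x ∈ A), G x = g ⟨x, hx⟩ := fun x hx => by
    have := DFunLike.congr_fun hG ⟨x, hx⟩
    simpa using this
  refine ⟨⟨fun x => G x - G (-x), by fun_prop⟩, fun x => by simp, fun x hx => ?_⟩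
  have hx' : pr (-x) ∈ A := by rwa [pr_neg]
  simp only [ContinuousMap.coe_mk, hG' x hx, hG' (-x) hx', hodd ⟨x, hx⟩ ⟨-x, hx'⟩ rfl]
  intro h
  apply h0 ⟨x, hx⟩
  have : (2 : ℝ) • g ⟨x, hx⟩ = 0 := by rw [two_smul]; simpa using h
  simpa using this

lemma OM_singleton (y : P2) : OM {y} 1 := by
  obtain ⟨q, rfl⟩ := pr_surj y
  refine ⟨⟨fun x _ => inner ℝ (x : E3) q, by fun_prop⟩, fun x => ?_, fun x hx h0 => ?_⟩
  · ext; simp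
  · have h1 := congrFun h0 0
    have hq : inner ℝ (q : E3) q = (1 : ℝ) := by rw [real_inner_self_eq_norm_sq]; simp
    rcases pr_eq_iff.1 hx with rfl | rfl
    · simp only [ContinuousMap.coe_mk, Pi.zero_apply] at h1; linarith
    · simp only [ContinuousMap.coe_mk, Pi.zero_apply, coe_neg_sphere, inner_neg_left] at h1; linarith

lemma OM_of_bringsTo {X Y : Set P2} (hX : IsClosed X) {k : ℕ} (hXY : BringsTo X Y)
    (hY : OM Y k) : OM X k := by
  obtain ⟨H, H0, H1⟩ := hXY
  obtain ⟨h, hodd, hne⟩ := hY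
  let HH : C(I × (pr ⁻¹' X), P2) :=
    ⟨fun p => H (⟨pr p.2, p.2.2⟩, p.1), by
      have := pr_cont
      fun_prop⟩
  let ff : C(pr ⁻¹' X, S2) := ⟨Subtype.val, continuous_subtype_val⟩
  have hz : ∀ a, HH (0, a) = pr (ff a) := fun a => H0 _
  let L := pr_cov.liftHomotopy HH ff hz
  have hL : ∀ p, pr (L p) = HH p := fun p => congrFun (pr_cov.liftHomotopy_lifts HH ff hz) p
  have hL0 : ∀ a, L (0, a) = a := fun a => pr_cov.liftHomotopy_zero HH ff hz a
  refine OM_of_partial hX (fun x => h (L (1, x))) (by fun_prop) ?_ ?_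
  · intro x y hxy
    have hp : pr (y : S2) = pr (x : S2) := by rw [hxy, pr_neg]
    have key : (fun t : I => L (t, y)) = fun t : I => -L (t, x) := by
      refine pr_cov.eq_of_comp_eq (by fun_prop) (by fun_prop) ?_ 0 ?_
      · ext t
        simp only [Function.comp, pr_neg, hL]
        simp only [HH, ContinuousMap.coe_mk, hp]
      · simp only [hL0, hxy]
    have : L (1, y) = -L (1, x) := congrFun key 1
    rw [this, hodd]
  · intro x
    apply hne
    rw [hL]
    exact H1 _

def nrm (v : E3) (hv : v ≠ 0) : S2 :=
  ⟨‖v‖⁻¹ • v, by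
    have : ‖v‖ ≠ 0 := norm_ne_zero_iff.2 hv
    rw [mem_sphere_zero_iff_norm, norm_smul, norm_inv, norm_norm, inv_mul_cancel₀ this]⟩

def basept : S2 := nrm (EuclideanSpace.single 0 1) (by simp)

def prv (v : E3) : P2 := if hv : v ≠ 0 then pr (nrm v hv) else pr basept

lemma prv_of_ne {v : E3} (hv : v ≠ 0) : prv v = pr (nrm v hv) := by simp [prv, hv]

lemma prv_neg (v : E3) : prv (-v) = prv v := by
  by_cases hv : v = 0
  · simp [hv]
  · rw [prv_of_ne hv, prv_of_ne (neg_ne_zero.2 hv), ← pr_neg]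
    congr 1
    ext1
    simp [nrm]

lemma prv_coe (x : S2) : prv (x : E3) = pr x := by
  have hn : ‖(x : E3)‖ = 1 := by simp
  have : (x : E3) ≠ 0 := by intro h; rw [h] at hn; simp at hn
  rw [prv_of_ne this]
  congr 1
  ext1
  simp [nrm]

lemma prv_cont {T : Type*} [TopologicalSpace T] {F : T → E3} (hF : Continuous F)
    (h0 : ∀ t, F t ≠ 0) : Continuous fun t => prv (F t) := by
  have : (fun t => prv (F t)) = fun t => pr (nrm (F t) (h0 t)) := by
    ext t; rw [prv_of_ne (h0 t)]
  rw [this]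
  refine pr_cont.comp ?_
  refine Continuous.subtype_mk ?_ _
  exact (hF.norm.inv₀ fun t => norm_ne_zero_iff.2 (h0 t)).smul hF

lemma descend {X : Set P2} {T : Type*} [TopologicalSpace T] (F : (pr ⁻¹' X) × T → E3)
    (hF : Continuous F) (h0 : ∀ p, F p ≠ 0)
    (hodd : ∀ (x y : pr ⁻¹' X) (t : T), (y : S2) = -(x : S2) → F (y, t) = -F (x, t)) :
    ∃ G : C(X × T, P2), ∀ (x : pr ⁻¹' X) (t : T), G (⟨pr x, x.2⟩, t) = prv (F (x, t)) := by
  have hq : IsOpenQuotientMap (Prod.map (X.restrictPreimage pr) (id : T → T)) :=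
    (pr_open.restrictPreimage X).prodMap .id
  have hsurj := hq.surjective
  have hfac : ∀ p q : (pr ⁻¹' X) × T,
      Prod.map (X.restrictPreimage pr) (id : T → T) p = Prod.map (X.restrictPreimage pr) id q →
      prv (F p) = prv (F q) := by
    rintro ⟨x, t⟩ ⟨y, s⟩ h
    simp only [Prod.map, id, Prod.mk.injEq] at h
    obtain ⟨h1, rfl⟩ := h
    have h2 : pr (x : S2) = pr (y : S2) := congrArg Subtype.val h1
    rcases pr_eq_iff.1 h2 with h3 | h3
    · rw [Subtype.ext h3]
    · rw [hodd y x t h3, prv_neg]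
  choose sec hsec using hsurj
  have hG : ∀ p, prv (F (sec (Prod.map (X.restrictPreimage pr) (id : T → T) p))) = prv (F p) :=
    fun p => hfac _ _ (hsec _)
  refine ⟨⟨fun p => prv (F (sec p)), ?_⟩, fun x t => hG (x, t)⟩
  rw [← hq.continuous_comp_iff]
  refine (prv_cont hF h0).congr fun p => ?_
  exact (hG p).symm

/-- `G` is induced by the odd nonvanishing map `g` -/
structure Induces {X : Set P2} (g : (pr ⁻¹' X) → E3) (G : C(X, P2)) : Prop where
  cont : Continuous g
  ne : ∀ x, g x ≠ 0
  odd : ∀ (x y : pr ⁻¹' X), (y : S2) = -(x : S2) → g y = -g x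
  eq : ∀ x : pr ⁻¹' X, G ⟨pr x, x.2⟩ = prv (g x)

lemma exists_induces {X : Set P2} {g : (pr ⁻¹' X) → E3} (h1 : Continuous g) (h2 : ∀ x, g x ≠ 0)
    (h3 : ∀ (x y : pr ⁻¹' X), (y : S2) = -(x : S2) → g y = -g x) : ∃ G, Induces g G := by
  obtain ⟨G, hG⟩ := descend (X := X) (T := Unit) (fun p => g p.1) (by fun_prop) (fun p => h2 _)
    (fun x y t => h3 x y)
  exact ⟨⟨fun x => G (x, ()), by fun_prop⟩, h1, h2, h3, fun x => hG x ()⟩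

lemma Induces.homotopic {X : Set P2} {g g' : (pr ⁻¹' X) → E3} {G G' : C(X, P2)}
    (h : Induces g G) (h' : Induces g' G')
    (hseg : ∀ x, ∀ t : ℝ, 0 ≤ t → t ≤ 1 → (1 - t) • g x + t • g' x ≠ 0) : G.Homotopic G' := by
  have := h.cont
  have := h'.cont
  obtain ⟨K, hK⟩ := descend (X := X) (T := I)
    (fun p => (1 - (p.2 : ℝ)) • g p.1 + (p.2 : ℝ) • g' p.1) (by fun_prop)
    (fun p => hseg _ _ p.2.2.1 p.2.2.2) (fun x y t hxy => by
      simp only [h.odd x y hxy, h'.odd x y hxy, smul_neg]; abel)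
  have hs : ∀ y : X, ∃ x : pr ⁻¹' X, (⟨pr x, x.2⟩ : X) = y := by
    rintro ⟨y, hy⟩
    obtain ⟨x, rfl⟩ := pr_surj y
    exact ⟨⟨x, hy⟩, rfl⟩
  refine ⟨⟨⟨fun p => K (p.2, p.1), by fun_prop⟩, fun y => ?_, fun y => ?_⟩⟩
  · obtain ⟨x, rfl⟩ := hs y
    simp [hK, h.eq]
  · obtain ⟨x, rfl⟩ := hs y
    simp [hK, h'.eq]

def inclX (X : Set P2) : C(X, P2) := ⟨Subtype.val, continuous_subtype_val⟩

lemma induces_incl (X : Set P2) : Induces (fun x : pr ⁻¹' X => ((x : S2) : E3)) (inclX X) := by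
  refine ⟨by fun_prop, fun x h => ?_, fun x y h => by simp [h], fun x => (prv_coe _).symm⟩
  have hn : ‖((x : S2) : E3)‖ = 1 := by simp
  rw [h] at hn; simp at hn

lemma bringsTo_of_homotopic {X Y : Set P2} {G : C(X, P2)} (h : (inclX X).Homotopic G)
    (hY : ∀ x, G x ∈ Y) : BringsTo X Y := by
  obtain ⟨K⟩ := h
  refine ⟨⟨fun p => K (p.2, p.1), by fun_prop⟩, fun x => ?_, fun x => ?_⟩
  · exact K.apply_zero x
  · have := K.apply_one x
    simp only [ContinuousMap.coe_mk]
    rw [this]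
    exact hY x

lemma seg_ne {a b : E3} (ha : ‖a‖ = 1) (hb : ‖b‖ = 1) (hab : b ≠ -a) (t : ℝ) (h0 : 0 ≤ t)
    (h1 : t ≤ 1) : (1 - t) • a + t • b ≠ 0 := by
  intro h
  have e : (1 - t) • a = - (t • b) := eq_neg_of_add_eq_zero_left h
  have e2 := congrArg norm e
  rw [norm_neg, norm_smul, norm_smul, ha, hb, Real.norm_of_nonneg (by linarith),
    Real.norm_of_nonneg h0] at e2
  have ht : t = 1 / 2 := by linarith
  subst ht
  apply hab
  have : (1 / 2 : ℝ) • b = (1 / 2 : ℝ) • (-a) := by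
    rw [smul_neg, eq_neg_iff_add_eq_zero, add_comm, ← h]; norm_num
  exact smul_right_injective E3 (by norm_num : (1 / 2 : ℝ) ≠ 0) this

lemma bringsTo_point {X : Set P2} (h : OM X 1) (y : P2) : BringsTo X {y} := by
  obtain ⟨h, hodd, hne⟩ := h
  obtain ⟨q₀, hq₀⟩ := pr_surj y
  have hh : ∀ x : pr ⁻¹' X, h x 0 ≠ 0 := fun x hx => hne x x.2 (by
    ext i; rw [Subsingleton.elim i 0, hx]; rfl)
  -- choose the sign of `q`
  obtain ⟨q, hq, hqD⟩ : ∃ q : S2, pr q = y ∧ ¬ (pr (-q) ∈ X ∧ 0 < h (-q) 0) := by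
    by_cases hc : pr (-q₀) ∈ X ∧ 0 < h (-q₀) 0
    · refine ⟨-q₀, by rw [pr_neg, hq₀], ?_⟩
      rintro ⟨-, h2⟩
      rw [hodd] at h2
      have h3 := hc.2
      rw [hodd] at h3
      simp [hodd] at h2 h3
      linarith
    · exact ⟨q₀, hq₀, hc⟩
  let s : pr ⁻¹' X → ℝ := fun x => h x 0 / |h x 0|
  have hs1 : ∀ x, s x = 1 ∧ 0 < h x 0 ∨ s x = -1 ∧ h x 0 < 0 := by
    intro x
    rcases lt_or_gt_of_ne (hh x) with hx | hx
    · right; refine ⟨?_, hx⟩; simp only [s, abs_of_neg hx]; rw [div_neg, div_self hx.ne]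
    · left; refine ⟨?_, hx⟩; simp only [s, abs_of_pos hx]; rw [div_self hx.ne']
  have hscont : Continuous s := by
    have : Continuous fun x : pr ⁻¹' X => h x 0 := by fun_prop
    exact this.div this.abs fun x => abs_ne_zero.2 (hh x)
  have hqn : ‖(q : E3)‖ = 1 := by simp
  obtain ⟨G, hG⟩ := exists_induces (X := X) (g := fun x => s x • (q : E3)) (by fun_prop)
    (fun x h0 => by
      have := congrArg norm h0
      rcases hs1 x with ⟨h1, -⟩ | ⟨h1, -⟩ <;> simp [h1] at this)
    (fun x y hxy => by simp [s, hxy, hodd, neg_div])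
  refine bringsTo_of_homotopic (G := G) ?_ ?_
  · refine (induces_incl X).homotopic hG fun x t h0 h1 => ?_
    refine seg_ne (by simp) ?_ ?_ t h0 h1
    · rcases hs1 x with ⟨h1, -⟩ | ⟨h1, -⟩ <;> simp [h1]
    · intro he
      apply hqD
      rcases hs1 x with ⟨h1, h2⟩ | ⟨h1, h2⟩
      · rw [h1, one_smul] at he
        have : -q = (x : S2) := by ext1; simp [he]
        rw [this]; exact ⟨x.2, h2⟩
      · rw [h1, neg_one_smul, neg_inj] at he
        have : q = (x : S2) := by ext1; simp [he]
        rw [pr_neg, this, hodd]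
        exact ⟨x.2, by simpa using h2⟩
  · rintro ⟨y', hy'⟩
    obtain ⟨x, rfl⟩ := pr_surj y'
    have := hG.eq ⟨x, hy'⟩
    simp only at this
    rw [this]
    rcases hs1 ⟨x, hy'⟩ with ⟨h1, -⟩ | ⟨h1, -⟩
    · rw [h1, one_smul, prv_coe]; exact hq
    · rw [h1, neg_one_smul, prv_neg, prv_coe]; exact hq

lemma contractibleIn_iff_bringsTo {X : Set P2} : ContractibleIn X ↔ ∃ y, BringsTo X {y} := Iff.rfl

lemma catLS_le_of_OM {A : Set P2} (hA : IsClosed A) {k : ℕ} (h : OM A k) : catLS A ≤ k := by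
  obtain ⟨h, hodd, hne⟩ := h
  have hcl : IsCompact (pr ⁻¹' A) := (hA.preimage pr_cont).isCompact
  obtain ⟨δ, hδ, hδ'⟩ : ∃ δ > 0, ∀ x, pr x ∈ A → δ ≤ ‖h x‖ := by
    rcases (pr ⁻¹' A).eq_empty_or_nonempty with he | hn
    · exact ⟨1, one_pos, fun x hx => absurd (show x ∈ pr ⁻¹' A from hx) (by simp [he])⟩
    · obtain ⟨x₀, hx₀, hmin⟩ := hcl.exists_isMinOn hn (f := fun x => ‖h x‖) (by fun_prop)
      exact ⟨‖h x₀‖, norm_pos_iff.2 (hne _ hx₀), fun x hx => hmin hx⟩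
  apply sInf_le
  refine ⟨k, rfl, fun i => {y | ∀ x, pr x = y → δ ≤ |h x i|}, ?_, ?_, ?_⟩
  · intro i
    rw [← pr_quotientMap.isClosed_preimage]
    have : pr ⁻¹' {y | ∀ x, pr x = y → δ ≤ |h x i|} = {x | δ ≤ |h x i|} := by
      ext x
      simp only [mem_preimage, mem_setOf_eq]
      refine ⟨fun H => H x rfl, fun H y hy => ?_⟩
      rcases pr_eq_iff.1 hy with rfl | rfl
      · exact H
      · simpa [hodd] using H
    rw [this]
    exact isClosed_le (by fun_prop) (by fun_prop)
  · intro i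
    refine ⟨pr basept, bringsTo_point ⟨⟨fun x _ => h x i, by fun_prop⟩, fun x => ?_, fun x hx h0 => ?_⟩ _⟩
    · ext; simp [hodd]
    · have h1 := hx x rfl
      have h2 : h x i = 0 := congrFun h0 0
      rw [h2] at h1; simp at h1; linarith
  · intro y hy
    obtain ⟨x, rfl⟩ := pr_surj y
    have h1 := hδ' x hy
    by_contra hcon
    simp only [mem_iUnion, mem_setOf_eq, not_exists] at hcon
    have h2 : ‖h x‖ < δ := by
      rw [pi_norm_lt_iff hδ]
      intro i
      have := hcon i
      push Not at this
      obtain ⟨z, hz, hz'⟩ := this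
      rcases pr_eq_iff.1 hz with rfl | rfl
      · exact hz'
      · simpa [hodd] using hz'
    linarith

lemma OM_of_catLS_le {A : Set P2} {k : ℕ} (h : catLS A ≤ k) : OM A k := by
  have hne : {m : ℕ∞ | ∃ k : ℕ, m = k ∧ ∃ C : Fin k → Set P2,
    (∀ i, IsClosed (C i)) ∧ (∀ i, ContractibleIn (C i)) ∧ A ⊆ ⋃ i, C i}.Nonempty := by
    rw [Set.nonempty_iff_ne_empty]
    intro he
    unfold catLS at h
    rw [he] at h
    simp at h
  obtain ⟨j, hj, C, hC1, hC2, hC3⟩ := csInf_mem hne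
  have hjk : j ≤ k := by
    have : (j : ℕ∞) ≤ k := by rw [← hj]; exact h
    exact_mod_cast this
  refine OM.mono_k ?_ hjk
  have hO : ∀ i, OM (C i) 1 := fun i => by
    obtain ⟨y, hy⟩ := contractibleIn_iff_bringsTo.1 (hC2 i)
    exact OM_of_bringsTo (hC1 i) hy (OM_singleton y)
  choose g hg1 hg2 using hO
  refine ⟨⟨fun x i => g i x 0, by fun_prop⟩, fun x => ?_, fun x hx h0 => ?_⟩
  · ext i; simp [hg1]
  · obtain ⟨i, hi⟩ := mem_iUnion.1 (hC3 hx)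
    apply hg2 i x hi
    ext j'
    rw [Subsingleton.elim j' 0]
    exact congrFun h0 i

lemma succ_le_catLS_iff {A : Set P2} (hA : IsClosed A) {k : ℕ} :
    ((k + 1 : ℕ) : ℕ∞) ≤ catLS A ↔ ¬ OM A k := by
  have : OM A k ↔ catLS A ≤ k := ⟨catLS_le_of_OM hA, OM_of_catLS_le⟩
  rw [this, not_le]
  push_cast
  exact ENat.add_one_le_iff (ENat.coe_ne_top k)

lemma frame (p : S2) : ∃ e₁ e₂ : E3, inner ℝ e₁ e₁ = (1 : ℝ) ∧ inner ℝ e₂ e₂ = (1 : ℝ) ∧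
    inner ℝ e₁ e₂ = (0 : ℝ) ∧
    ∀ x : S2, inner ℝ e₁ (x : E3) = (0 : ℝ) → inner ℝ e₂ (x : E3) = (0 : ℝ) → pr x = pr p := by
  have hp : ‖(p : E3)‖ = 1 := by simp
  obtain ⟨b, hb⟩ := Orthonormal.exists_orthonormalBasis_extension_of_card_eq (𝕜 := ℝ) (E := E3)
    (ι := Fin 3) (by simp) (v := fun _ => (p : E3)) (s := {2}) (by
      rw [orthonormal_iff_ite]
      rintro ⟨i, hi⟩ ⟨j, hj⟩
      have hi' : i = 2 := hi
      have hj' : j = 2 := hj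
      subst hi' hj'
      simp [Set.restrict])
  have hb2 : b 2 = (p : E3) := hb 2 rfl
  have ho := orthonormal_iff_ite.1 b.orthonormal
  refine ⟨b 0, b 1, by simp [ho], by simp [ho], by simp [ho], fun x h0 h1 => ?_⟩
  have hx := b.sum_repr' (x : E3)
  rw [Fin.sum_univ_three, h0, h1, hb2, zero_smul, zero_smul, zero_add, zero_add] at hx
  set c : ℝ := inner ℝ (p : E3) (x : E3) with hc
  have hn := congrArg norm hx
  rw [norm_smul, hp, mul_one] at hn
  have hx1 : ‖(x : E3)‖ = 1 := by simp
  rw [hx1, Real.norm_eq_abs] at hn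
  rw [pr_eq_iff]
  rcases eq_or_eq_neg_of_abs_eq hn with h | h
  · left; ext1; rw [← hx, h, one_smul]
  · right; ext1; rw [← hx, h]; simp

lemma exists_not_mem {A : Set P2} (h : A ≠ univ) : ∃ p : S2, pr p ∉ A := by
  obtain ⟨y, hy⟩ := (Set.ne_univ_iff_exists_notMem A).1 h
  obtain ⟨p, rfl⟩ := pr_surj y
  exact ⟨p, hy⟩

lemma OM_two_of_ne_univ {A : Set P2} (h : A ≠ univ) : OM A 2 := by
  obtain ⟨p, hp⟩ := exists_not_mem h
  obtain ⟨e₁, e₂, -, -, -, he⟩ := frame p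
  refine ⟨⟨fun x => ![inner ℝ e₁ (x : E3), inner ℝ e₂ (x : E3)], ?_⟩, fun x => ?_, fun x hx h0 => ?_⟩
  · refine continuous_pi fun i => ?_
    fin_cases i <;> simp <;> fun_prop
  · ext i; fin_cases i <;> simp
  · have h1 := congrFun h0 0
    have h2 := congrFun h0 1
    simp at h1 h2
    exact hp (he x h1 h2 ▸ hx)

def hemiV (z : ℂ) : E3 := !₂[z.re, z.im, max 0 (1 - ‖z‖)]

lemma hemiV_cont : Continuous hemiV := by
  unfold hemiV
  refine (PiLp.continuous_toLp 2 _).comp ?_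
  refine continuous_pi fun i => ?_
  fin_cases i <;> simp <;> fun_prop

lemma hemiV_ne (z : ℂ) : hemiV z ≠ 0 := by
  intro h
  have h0 : z.re = 0 := by simpa [hemiV] using congrArg (fun v : E3 => v 0) h
  have h1 : z.im = 0 := by simpa [hemiV] using congrArg (fun v : E3 => v 1) h
  have h2 : max 0 (1 - ‖z‖) = 0 := by simpa [hemiV] using congrArg (fun v : E3 => v 2) h
  have hz : z = 0 := Complex.ext h0 h1
  simp [hz] at h2

lemma hemiV_neg {z : ℂ} (hz : ‖z‖ = 1) : hemiV (-z) = -hemiV z := by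
  ext i
  fin_cases i <;> simp [hemiV, hz]

lemma not_OM_univ : ¬ OM univ 2 := by
  rintro ⟨h, hodd, hne⟩
  let φ : ℂ → S2 := fun z => nrm (hemiV z) (hemiV_ne z)
  have hφ : Continuous φ := by
    refine Continuous.subtype_mk ?_ _
    exact (hemiV_cont.norm.inv₀ fun t => norm_ne_zero_iff.2 (hemiV_ne t)).smul hemiV_cont
  have hφn : ∀ z : ℂ, ‖z‖ = 1 → φ (-z) = -φ z := fun z hz => by
    ext1
    simp [φ, nrm, hemiV_neg hz]
  let k : ℂ → ℂ := fun z => ⟨h (φ z) 0, h (φ z) 1⟩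
  have hk0 : ∀ z, k z ≠ 0 := fun z hz => by
    apply hne (φ z) trivial
    have h1 := congrArg Complex.re hz
    have h2 := congrArg Complex.im hz
    simp only [k, Complex.zero_re, Complex.zero_im] at h1 h2
    ext i; fin_cases i
    · exact h1
    · exact h2
  have hkc : Continuous k := by
    have : k = fun z => (h (φ z) 0 : ℂ) + (h (φ z) 1 : ℂ) * Complex.I := by
      ext z; exact (Complex.mk_eq_add_mul_I _ _)
    rw [this]
    fun_prop
  have hkn : ∀ z : ℂ, ‖z‖ = 1 → k (-z) = -k z := fun z hz => by
    simp only [k, hφn z hz, hodd]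
    apply Complex.ext <;> simp
  obtain ⟨θ, ⟨-, hθ⟩, -⟩ := Complex.isCoveringMap_exp.existsUnique_continuousMap_lifts
    (⟨fun z => ⟨k z, hk0 z⟩, by fun_prop⟩ : C(ℂ, {z : ℂ // z ≠ 0})) (a₀ := 0) (e₀ := Complex.log (k 0))
    (by simp [Complex.exp_log (hk0 0)])
  have hθ' : ∀ z, Complex.exp (θ z) = k z := fun z => congrArg Subtype.val (congrFun hθ z)
  let d : ℝ → ℝ := fun t => (θ (-Complex.exp (t * Complex.I)) - θ (Complex.exp (t * Complex.I))).im
  have hd : Continuous d := by fun_prop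
  have hdπ : d Real.pi = - d 0 := by
    simp [d, Complex.exp_pi_mul_I]
  obtain ⟨t, ht⟩ : ∃ t, d t = 0 := by
    rcases le_total (d 0) 0 with h0 | h0
    · exact mem_range_of_exists_le_of_exists_ge hd ⟨0, h0⟩ ⟨Real.pi, by linarith⟩
    · exact mem_range_of_exists_le_of_exists_ge hd ⟨Real.pi, by linarith⟩ ⟨0, h0⟩
  set w := Complex.exp (t * Complex.I) with hw
  have hw1 : ‖w‖ = 1 := Complex.norm_exp_ofReal_mul_I t
  have e1 : Complex.exp (θ (-w) - θ w) = -1 := by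
    rw [Complex.exp_sub, hθ', hθ', hkn w hw1, neg_div, div_self (hk0 w)]
  have e2 : θ (-w) - θ w = ((θ (-w) - θ w).re : ℂ) := by
    apply Complex.ext
    · simp
    · have ht' : (θ (-w) - θ w).im = 0 := ht
      rw [ht']; simp
  rw [e2, ← Complex.ofReal_exp] at e1
  have e3 : Real.exp (θ (-w) - θ w).re = -1 := by exact_mod_cast e1
  have := Real.exp_pos (θ (-w) - θ w).re
  linarith

lemma S2_lpc : LocallyPathConnectedSpace S2 := by
  have : Fact (Module.finrank ℝ E3 = 2 + 1) := ⟨by simp⟩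
  exact ChartedSpace.locallyPathConnectedSpace (EuclideanSpace ℝ (Fin 2)) S2

lemma joinedIn_neg {W : Set S2} (hW : ∀ x ∈ W, -x ∈ W) {x y : S2} (h : JoinedIn W x y) :
    JoinedIn W (-x) (-y) := by
  obtain ⟨γ, hγ⟩ := h
  exact ⟨γ.map continuous_neg, fun t => hW _ (hγ t)⟩

lemma exists_joined {U A : Set P2} (hU : IsOpen U) (hA : IsClosed A) (hA1 : ¬ OM A 1)
    (hAU : A ⊆ U) : ∃ x, JoinedIn (pr ⁻¹' U) x (-x) := by
  by_contra hcon
  push Not at hcon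
  apply hA1
  have := S2_lpc
  set W : Set S2 := pr ⁻¹' U with hWdef
  have hWo : IsOpen W := hU.preimage pr_cont
  have hWn : ∀ x ∈ W, -x ∈ W := fun x hx => by
    change pr (-x) ∈ U
    rw [pr_neg]; exact hx
  let c : S2 → Set S2 := fun x => pathComponentIn W x
  have hceq : ∀ x y, JoinedIn W x y → c x = c y := by
    intro x y h
    ext z
    exact ⟨fun hz => h.symm.trans hz, fun hz => h.trans hz⟩
  have hcne : ∀ x ∈ W, c x ≠ c (-x) := by
    intro x hx h
    have : -x ∈ c (-x) := JoinedIn.refl (hWn x hx)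
    rw [← h] at this
    exact hcon x this
  let s : S2 → ℝ := fun x => if WellOrderingRel (c x) (c (-x)) then 1 else -1
  have hs_eq : ∀ x y, JoinedIn W x y → s y = s x := by
    intro x y h
    simp only [s]
    rw [hceq x y h, hceq _ _ (joinedIn_neg hWn h)]
  have hs_neg : ∀ x ∈ W, s (-x) = - s x := by
    intro x hx
    simp only [s, neg_neg]
    rcases trichotomous_of WellOrderingRel (c x) (c (-x)) with h | h | h
    · have h' : ¬ WellOrderingRel (c (-x)) (c x) := asymm_of WellOrderingRel h
      simp [h, h']
    · exact absurd h (hcne x hx)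
    · have h' : ¬ WellOrderingRel (c x) (c (-x)) := asymm_of WellOrderingRel h
      simp [h, h']
  refine OM_of_partial hA (fun x _ => s x) ?_ ?_ ?_
  · refine continuous_pi fun _ => ?_
    refine IsLocallyConstant.continuous (X := pr ⁻¹' A) (f := fun x : pr ⁻¹' A => s x) ?_
    rw [IsLocallyConstant.iff_eventually_eq]
    intro x
    have hx : (x : S2) ∈ W := hAU x.2
    have hn : pathComponentIn W (x : S2) ∈ 𝓝 (x : S2) := pathComponentIn_mem_nhds (hWo.mem_nhds hx)
    filter_upwards [continuous_subtype_val.continuousAt.preimage_mem_nhds hn] with y hy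
    exact hs_eq _ _ hy
  · intro x y hxy
    ext
    simp only [Pi.neg_apply, hxy]
    exact hs_neg _ (hAU x.2)
  · intro x h0
    have h1 : s x = 0 := congrFun h0 0
    simp only [s] at h1
    split_ifs at h1 <;> norm_num at h1

lemma approx {g : ℝ → E3} (hg : Continuous g) (h01 : g 1 = -g 0) :
    ∃ P : ℝ → E3, ContDiff ℝ 1 P ∧ P 1 = -P 0 ∧ ∀ s ∈ Icc (0 : ℝ) 1, ‖P s - g s‖ < 1 / 2 := by
  have hex : ∀ i : Fin 3, ∃ p : Polynomial ℝ, ∀ x ∈ Icc (0 : ℝ) 1, |p.eval x - g x i| < 1 / 8 :=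
    fun i => exists_polynomial_near_of_continuousOn 0 1 (fun x => g x i) (by fun_prop) _ (by norm_num)
  choose p hp using hex
  let Q : ℝ → E3 := fun s => WithLp.toLp 2 fun i => (p i).eval s
  have hQ : ContDiff ℝ 1 Q := by
    rw [contDiff_euclidean]
    intro i
    simpa [Q, Polynomial.aeval_def, Polynomial.eval₂_eq_eval_map] using Polynomial.contDiff_aeval (𝕜 := ℝ) (p i) 1
  have hQg : ∀ s ∈ Icc (0 : ℝ) 1, ‖Q s - g s‖ < 1 / 4 := by
    intro s hs
    rw [EuclideanSpace.norm_eq, Real.sqrt_lt' (by norm_num), Fin.sum_univ_three]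
    have hb : ∀ i, ‖(Q s - g s) i‖ ^ 2 < 1 / 64 := fun i => by
      have h1 := hp i s hs
      have h2 : (Q s - g s) i = (p i).eval s - g s i := by simp [Q]
      rw [h2, Real.norm_eq_abs]
      have := abs_nonneg ((p i).eval s - g s i)
      nlinarith
    have := hb 0
    have := hb 1
    have := hb 2
    have e4 : ((1 : ℝ) / 4) ^ 2 = 1 / 16 := by norm_num
    rw [e4]; linarith
  refine ⟨fun s => Q s - (1 / 2 : ℝ) • (Q 0 + Q 1), by fun_prop, ?_, fun s hs => ?_⟩
  · module
  · have h0 := hQg 0 (by simp)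
    have h1 := hQg 1 (by simp)
    have hsq := hQg s hs
    have e : Q s - (1 / 2 : ℝ) • (Q 0 + Q 1) - g s =
        (Q s - g s) - (1 / 2 : ℝ) • ((Q 0 - g 0) + (Q 1 - g 1)) := by
      rw [h01]; module
    have n1 : ‖(1 / 2 : ℝ) • ((Q 0 - g 0) + (Q 1 - g 1))‖ < 1 / 4 := by
      rw [norm_smul]
      have := norm_add_le (Q 0 - g 0) (Q 1 - g 1)
      norm_num
      linarith
    rw [e]
    have := norm_sub_le (Q s - g s) ((1 / 2 : ℝ) • ((Q 0 - g 0) + (Q 1 - g 1)))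
    linarith

lemma generic {P : ℝ → E3} (hP : ContDiff ℝ 1 P) (e₁ e₂ : E3) :
    ∃ v₁ v₂ : E3, ‖v₁‖ < 1 / 8 ∧ ‖v₂‖ < 1 / 8 ∧ ∀ a b c : ℝ, a ^ 2 + b ^ 2 = 1 →
      P ((1 - a) / 2) + a • v₁ + b • v₂ ≠ -(c • (a • e₁ + b • e₂)) := by
  let m : ℝ × ℝ × E3 → E3 := fun w =>
    -(w.2.1 • (Real.cos w.1 • e₁ + Real.sin w.1 • e₂)) - P ((1 - Real.cos w.1) / 2)
  let F : ℝ × ℝ × E3 → E3 × E3 := fun w =>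
    (Real.cos w.1 • m w - Real.sin w.1 • w.2.2, Real.sin w.1 • m w + Real.cos w.1 • w.2.2)
  have hc : ContDiff ℝ 1 fun w : ℝ × ℝ × E3 => Real.cos w.1 := Real.contDiff_cos.comp contDiff_fst
  have hs : ContDiff ℝ 1 fun w : ℝ × ℝ × E3 => Real.sin w.1 := Real.contDiff_sin.comp contDiff_fst
  have hm : ContDiff ℝ 1 m := by
    have h1 : ContDiff ℝ 1 fun w : ℝ × ℝ × E3 => P ((1 - Real.cos w.1) / 2) :=
      hP.comp ((contDiff_const.sub hc).div_const 2)
    exact ((contDiff_fst.comp contDiff_snd).smul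
      ((hc.smul contDiff_const).add (hs.smul contDiff_const))).neg.sub h1
  have hF : ContDiff ℝ 1 F := by
    have h2 : ContDiff ℝ 1 fun w : ℝ × ℝ × E3 => w.2.2 := contDiff_snd.comp contDiff_snd
    exact ((hc.smul hm).sub (hs.smul h2)).prodMk ((hs.smul hm).add (hc.smul h2))
  have hd := hF.dense_compl_range_of_finrank_lt_finrank (by simp)
  obtain ⟨⟨v₁, v₂⟩, hv, hv'⟩ := hd.exists_dist_lt (0 : E3 × E3) (ε := 1 / 8) (by norm_num)
  rw [dist_comm, dist_zero_right, Prod.norm_mk, max_lt_iff] at hv'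
  refine ⟨v₁, v₂, hv'.1, hv'.2, fun a b c hab he => hv ?_⟩
  obtain ⟨θ, hθ1, hθ2⟩ : ∃ θ, Real.cos θ = a ∧ Real.sin θ = b := by
    have hz : ‖(⟨a, b⟩ : ℂ)‖ = 1 := by
      rw [Complex.norm_def, Complex.normSq_mk, ← sq, ← sq, hab, Real.sqrt_one]
    refine ⟨Complex.arg ⟨a, b⟩, ?_, ?_⟩
    · have := Complex.norm_mul_cos_arg ⟨a, b⟩
      rwa [hz, one_mul] at this
    · have := Complex.norm_mul_sin_arg ⟨a, b⟩
      rwa [hz, one_mul] at this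
  have hmv : m (θ, c, a • v₂ - b • v₁) = a • v₁ + b • v₂ := by
    simp only [m, hθ1, hθ2]
    rw [← he]
    abel
  refine ⟨(θ, c, a • v₂ - b • v₁), ?_⟩
  simp only [F, hmv, hθ1, hθ2]
  have hb : b ^ 2 = 1 - a ^ 2 := by linarith
  ext1
  · calc a • (a • v₁ + b • v₂) - b • (a • v₂ - b • v₁) = (a ^ 2 + b ^ 2) • v₁ := by module
      _ = v₁ := by rw [hab, one_smul]
  · calc b • (a • v₁ + b • v₂) + a • (a • v₂ - b • v₁) = (a ^ 2 + b ^ 2) • v₂ := by module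
      _ = v₂ := by rw [hab, one_smul]

/-- odd extension to the circle -/
def circ (q : ℝ → E3) (a b : ℝ) : E3 := if 0 ≤ b then q ((1 - a) / 2) else -q ((1 + a) / 2)

lemma circ_odd {q : ℝ → E3} (hq : q 1 = -q 0) {a b : ℝ} (hab : a ^ 2 + b ^ 2 = 1) :
    circ q (-a) (-b) = -circ q a b := by
  unfold circ
  rcases lt_trichotomy b 0 with hb | hb | hb
  · have h1 : (0 : ℝ) ≤ -b := by linarith
    simp [h1, not_le.2 hb]
  · subst hb
    have ha : a = 1 ∨ a = -1 := by
      have : a ^ 2 = 1 := by linarith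
      exact sq_eq_one_iff.1 this
    rcases ha with rfl | rfl
    · norm_num [hq]
    · norm_num [hq]
  · have h1 : ¬ (0 : ℝ) ≤ -b := by linarith
    simp only [h1, hb.le, if_true, if_false]
    rfl

lemma circ_cont {q : ℝ → E3} (hq : q 1 = -q 0) (hqc : Continuous q) {T : Type*}
    [TopologicalSpace T] {a b : T → ℝ} (ha : Continuous a) (hb : Continuous b)
    (hab : ∀ x, a x ^ 2 + b x ^ 2 = 1) : Continuous fun x => circ q (a x) (b x) := by
  unfold circ
  refine Continuous.if_le (by fun_prop) (by fun_prop) continuous_const hb fun x hx => ?_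
  have ha : a x = 1 ∨ a x = -1 := by
    have h := hab x
    rw [← hx] at h
    have : a x ^ 2 = 1 := by linarith
    exact sq_eq_one_iff.1 this
  rcases ha with h | h
  · norm_num [hq, h]
  · norm_num [hq, h]

lemma bringsTo_of_loop {X U A : Set P2} (hX : X ≠ univ) (hU : IsOpen U) (hA : IsClosed A)
    (hA1 : ¬ OM A 1) (hAU : A ⊆ U) : BringsTo X U := by
  obtain ⟨x₀, γ, hγ⟩ := exists_joined hU hA hA1 hAU
  let g : ℝ → E3 := fun s => (γ.extend s : E3)
  have hg : Continuous g := by fun_prop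
  have hg01 : g 1 = -g 0 := by simp [g]
  have hgn : ∀ s, ‖g s‖ = 1 := fun s => by simp [g]
  have hgU : ∀ s, prv (g s) ∈ U := fun s => by
    simp only [g]
    rw [prv_coe]
    exact hγ (projIcc 0 1 zero_le_one s)
  obtain ⟨P, hP, hP01, hPg⟩ := approx hg hg01
  obtain ⟨p, hp⟩ := exists_not_mem hX
  obtain ⟨e₁, e₂, h11, h22, h12, hfr⟩ := frame p
  have h21 : inner ℝ e₂ e₁ = (0 : ℝ) := by rw [real_inner_comm]; exact h12
  obtain ⟨v₁, v₂, hv₁, hv₂, hgen⟩ := generic hP e₁ e₂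
  have hgen' : ∀ a b c : ℝ, a ^ 2 + b ^ 2 = 1 →
      circ P a b + a • v₁ + b • v₂ ≠ -(c • (a • e₁ + b • e₂)) := by
    intro a b c hab
    by_cases hb : 0 ≤ b
    · simp only [circ, hb, if_true]
      exact hgen a b c hab
    · simp only [circ, hb, if_false]
      intro h
      apply hgen (-a) (-b) c (by simpa using hab)
      rw [sub_neg_eq_add]
      have h' := congrArg Neg.neg h
      calc P ((1 + a) / 2) + -a • v₁ + -b • v₂ = -(-P ((1 + a) / 2) + a • v₁ + b • v₂) := by module
        _ = _ := by rw [h]; module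
  let α : pr ⁻¹' X → ℝ := fun x => inner ℝ e₁ ((x : S2) : E3)
  let β : pr ⁻¹' X → ℝ := fun x => inner ℝ e₂ ((x : S2) : E3)
  have hα : Continuous α := by fun_prop
  have hβ : Continuous β := by fun_prop
  have hαβ : ∀ x, ¬ (α x = 0 ∧ β x = 0) := fun x ⟨h1, h2⟩ => by
    have := hfr x h1 h2
    exact hp (this ▸ x.2)
  let r : pr ⁻¹' X → ℝ := fun x => Real.sqrt (α x ^ 2 + β x ^ 2)
  have hrc : Continuous r := by fun_prop
  have hpos : ∀ x, 0 < α x ^ 2 + β x ^ 2 := fun x => by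
    by_contra hcon
    apply hαβ x
    constructor <;> nlinarith [sq_nonneg (α x), sq_nonneg (β x)]
  have hr0 : ∀ x, 0 < r x := fun x => Real.sqrt_pos.2 (hpos x)
  have hr2 : ∀ x, r x ^ 2 = α x ^ 2 + β x ^ 2 := fun x => Real.sq_sqrt (hpos x).le
  let a : pr ⁻¹' X → ℝ := fun x => α x / r x
  let b : pr ⁻¹' X → ℝ := fun x => β x / r x
  have ha : Continuous a := hα.div hrc fun x => (hr0 x).ne'
  have hb : Continuous b := hβ.div hrc fun x => (hr0 x).ne'
  have hab : ∀ x, a x ^ 2 + b x ^ 2 = 1 := fun x => by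
    simp only [a, b, div_pow, ← add_div, ← hr2]
    exact div_self (pow_ne_zero 2 (hr0 x).ne')
  have haα : ∀ x, α x = r x * a x := fun x => by
    simp only [a]; rw [mul_div_cancel₀ _ (hr0 x).ne']
  have hbβ : ∀ x, β x = r x * b x := fun x => by
    simp only [b]; rw [mul_div_cancel₀ _ (hr0 x).ne']
  have hαn : ∀ x y : pr ⁻¹' X, (y : S2) = -(x : S2) → α y = -α x := fun x y h => by simp [α, h]
  have hβn : ∀ x y : pr ⁻¹' X, (y : S2) = -(x : S2) → β y = -β x := fun x y h => by simp [β, h]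
  have hrn : ∀ x y : pr ⁻¹' X, (y : S2) = -(x : S2) → r y = r x := fun x y h => by
    simp [r, hαn x y h, hβn x y h]
  have han : ∀ x y : pr ⁻¹' X, (y : S2) = -(x : S2) → a y = -a x := fun x y h => by
    simp only [a, hαn x y h, hrn x y h, neg_div]
  have hbn : ∀ x y : pr ⁻¹' X, (y : S2) = -(x : S2) → b y = -b x := fun x y h => by
    simp only [b, hβn x y h, hrn x y h, neg_div]
  have hin1 : ∀ s t : ℝ, inner ℝ e₁ (s • e₁ + t • e₂) = s := fun s t => by
    rw [inner_add_right, inner_smul_right, inner_smul_right, h11, h12]; ring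
  have hin2 : ∀ s t : ℝ, inner ℝ e₂ (s • e₁ + t • e₂) = t := fun s t => by
    rw [inner_add_right, inner_smul_right, inner_smul_right, h21, h22]; ring
  -- the four maps
  obtain ⟨G₂, hG₂⟩ := exists_induces (X := X) (g := fun x => α x • e₁ + β x • e₂) (by fun_prop)
    (fun x h0 => hαβ x ⟨by rw [← hin1 (α x) (β x), h0, inner_zero_right],
      by rw [← hin2 (α x) (β x), h0, inner_zero_right]⟩)
    (fun x y h => by simp only [hαn x y h, hβn x y h]; module)
  have hcP := circ_cont hP01 hP.continuous ha hb hab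
  obtain ⟨G₃, hG₃⟩ := exists_induces (X := X)
    (g := fun x => circ P (a x) (b x) + a x • v₁ + b x • v₂) (by fun_prop)
    (fun x h0 => hgen' (a x) (b x) 0 (hab x) (by rw [h0]; simp))
    (fun x y h => by
      simp only [han x y h, hbn x y h, circ_odd hP01 (hab x)]; module)
  have hcn : ∀ s t, ‖circ g s t‖ = 1 := fun s t => by
    unfold circ; split_ifs <;> simp [hgn]
  obtain ⟨G₄, hG₄⟩ := exists_induces (X := X)
    (g := fun x => circ g (a x) (b x)) (circ_cont hg01 hg ha hb hab)
    (fun x h0 => by have := hcn (a x) (b x); rw [h0] at this; simp at this)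
    (fun x y h => by
      simp only [han x y h, hbn x y h, circ_odd hg01 (hab x)])
  have H12 : (inclX X).Homotopic G₂ := by
    refine (induces_incl X).homotopic hG₂ fun x t h0 h1 h => hαβ x ?_
    have i1 := congrArg (fun v => inner ℝ e₁ v) h
    have i2 := congrArg (fun v => inner ℝ e₂ v) h
    simp only [inner_zero_right] at i1 i2
    rw [inner_add_right, inner_smul_right, inner_smul_right, hin1] at i1
    rw [inner_add_right, inner_smul_right, inner_smul_right, hin2] at i2
    change (1 - t) * α x + t * α x = 0 at i1
    change (1 - t) * β x + t * β x = 0 at i2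
    constructor <;> linarith
  have H23 : G₂.Homotopic G₃ := by
    refine hG₂.homotopic hG₃ fun x t h0 h1 h => ?_
    rcases h0.eq_or_lt with rfl | ht
    · exact hG₂.ne x (by simpa using h)
    · apply hgen' (a x) (b x) ((1 - t) * r x / t) (hab x)
      rw [haα x, hbβ x] at h
      have e1 : t • (circ P (a x) (b x) + a x • v₁ + b x • v₂) =
          t • -(((1 - t) * r x / t) • (a x • e₁ + b x • e₂)) := by
        rw [smul_neg, smul_smul, mul_div_cancel₀ _ ht.ne', eq_neg_iff_add_eq_zero, ← h]
        module
      exact smul_right_injective E3 ht.ne' e1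
  have H34 : G₃.Homotopic G₄ := by
    refine hG₃.homotopic hG₄ fun x t h0 h1 h => ?_
    have ha1 : |a x| ≤ 1 := by
      rw [abs_le]; constructor <;> nlinarith [hab x, sq_nonneg (b x)]
    have hb1 : |b x| ≤ 1 := by
      rw [abs_le]; constructor <;> nlinarith [hab x, sq_nonneg (a x)]
    obtain ⟨ha2, ha3⟩ := abs_le.1 ha1
    have d1 : ‖circ P (a x) (b x) - circ g (a x) (b x)‖ < 1 / 2 := by
      unfold circ
      split_ifs
      · exact hPg _ ⟨by linarith, by linarith⟩
      · rw [← neg_add', norm_neg, ← sub_eq_add_neg]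
        exact hPg _ ⟨by linarith, by linarith⟩
    have d2 : ‖a x • v₁‖ ≤ 1 / 8 := by
      rw [norm_smul, Real.norm_eq_abs]; nlinarith [norm_nonneg v₁, abs_nonneg (a x)]
    have d3 : ‖b x • v₂‖ ≤ 1 / 8 := by
      rw [norm_smul, Real.norm_eq_abs]; nlinarith [norm_nonneg v₂, abs_nonneg (b x)]
    set D := (circ P (a x) (b x) - circ g (a x) (b x)) + a x • v₁ + b x • v₂ with hD
    have d4 : ‖D‖ < 1 := by
      have := norm_add_le (circ P (a x) (b x) - circ g (a x) (b x) + a x • v₁) (b x • v₂)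
      have := norm_add_le (circ P (a x) (b x) - circ g (a x) (b x)) (a x • v₁)
      linarith
    have e : circ g (a x) (b x) = -((1 - t) • D) := by
      rw [eq_neg_iff_add_eq_zero, ← h, hD]; module
    have n := congrArg norm e
    rw [hcn, norm_neg, norm_smul, Real.norm_of_nonneg (by linarith)] at n
    nlinarith [norm_nonneg D]
  refine bringsTo_of_homotopic ((H12.trans H23).trans H34) ?_
  rintro ⟨y, hy⟩
  obtain ⟨x, rfl⟩ := pr_surj y
  have := hG₄.eq ⟨x, hy⟩
  simp only at this
  rw [this]
  unfold circ
  split_ifs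
  · exact hgU _
  · rw [prv_neg]; exact hgU _

lemma hs_le_iff {f : P2 → ℝ} (hf : Continuous f) (k : ℕ) (a : ℝ) :
    hs f (k + 1) ≤ (a : EReal) ↔ ¬ OM {x | f x ≤ a} k := by
  have hcl : ∀ b : ℝ, IsClosed {x | f x ≤ b} := fun b => isClosed_le hf continuous_const
  constructor
  · rintro h ⟨g, hodd, hne⟩
    -- find a slightly larger level
    obtain ⟨b, hab, hb⟩ : ∃ b > a, ∀ x, f (pr x) < b → g x ≠ 0 := by
      have hZ : IsClosed {x : S2 | g x = 0} := isClosed_eq (by fun_prop) (by fun_prop)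
      rcases {x : S2 | g x = 0}.eq_empty_or_nonempty with he | hn
      · refine ⟨a + 1, by linarith, fun x _ h0 => ?_⟩
        have : x ∈ {x : S2 | g x = 0} := h0
        simp [he] at this
      · obtain ⟨x₀, hx₀, hmin⟩ := hZ.isCompact.exists_isMinOn hn (f := fun x => f (pr x))
          (hf.comp pr_cont).continuousOn
        refine ⟨f (pr x₀), ?_, fun x hx h0 => ?_⟩
        · by_contra hcon
          exact hne x₀ (not_lt.1 hcon) hx₀
        · exact absurd (hmin h0) (not_le.2 hx)
    have hlt : hs f (k + 1) < (b : EReal) := lt_of_le_of_lt h (by exact_mod_cast hab)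
    unfold hs at hlt
    simp only [iInf_lt_iff] at hlt
    obtain ⟨A, ⟨hA, hcat⟩, hsup⟩ := hlt
    refine (succ_le_catLS_iff hA).1 hcat ⟨g, hodd, fun x hx => hb x ?_⟩
    have : (f (pr x) : EReal) < b := lt_of_le_of_lt (le_iSup₂ (f := fun y (_ : y ∈ A) => (f y : EReal)) (pr x) hx) hsup
    exact_mod_cast this
  · intro h
    unfold hs
    refine iInf₂_le_of_le {x | f x ≤ a} ⟨hcl a, (succ_le_catLS_iff (hcl a)).2 h⟩ ?_
    refine iSup₂_le fun x hx => ?_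
    exact_mod_cast hx

lemma exists_of_hs_lt {f : P2 → ℝ} {k : ℕ} {a : ℝ} (h : hs f (k + 1) < (a : EReal)) :
    ∃ A : Set P2, IsClosed A ∧ ¬ OM A k ∧ A ⊆ {x | f x < a} := by
  unfold hs at h
  simp only [iInf_lt_iff] at h
  obtain ⟨A, ⟨hA, hcat⟩, hsup⟩ := h
  refine ⟨A, hA, (succ_le_catLS_iff hA).1 hcat, fun x hx => ?_⟩
  have : (f x : EReal) < a := lt_of_le_of_lt (le_iSup₂ (f := fun y (_ : y ∈ A) => (f y : EReal)) x hx) hsup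
  exact_mod_cast this

lemma significant_of_eq {f : P2 → ℝ} (hf : Continuous f) (k : ℕ) (a : ℝ)
    (h : (a : EReal) = hs f (k + 1)) : HomotopySignificant f a := by
  intro hB
  have hcl : IsClosed {x | f x ≤ a} := isClosed_le hf continuous_const
  have hno : ¬ OM {x | f x ≤ a} k := (hs_le_iff hf k a).1 h.ge
  have hne : Nonempty {x | f x ≤ a} := by
    by_contra hcon
    apply hno
    refine ⟨0, fun x => by simp, fun x hx => ?_⟩
    exact absurd ⟨⟨pr x, hx⟩⟩ hcon
  obtain ⟨H, H0, H1⟩ := hB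
  have hcs : CompactSpace {x | f x ≤ a} := isCompact_iff_compactSpace.1 hcl.isCompact
  obtain ⟨x₀, -, hmax⟩ := isCompact_univ.exists_isMaxOn (univ_nonempty (α := {x | f x ≤ a}))
    (f := fun x => f (H (x, 1))) (by fun_prop)
  have hlt : f (H (x₀, 1)) < a := H1 x₀
  have hB' : BringsTo {x | f x ≤ a} {x | f x ≤ f (H (x₀, 1))} :=
    ⟨H, H0, fun x => hmax (mem_univ x)⟩
  have hno' : ¬ OM {x | f x ≤ f (H (x₀, 1))} k := fun hO => hno (OM_of_bringsTo hcl hB' hO)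
  have := (hs_le_iff hf k _).2 hno'
  rw [← h] at this
  have : a ≤ f (H (x₀, 1)) := by exact_mod_cast this
  linarith

lemma eq_of_significant {f : P2 → ℝ} (hf : Continuous f) (a : ℝ) (h : HomotopySignificant f a) :
    (a : EReal) = hs f 1 ∨ (a : EReal) = hs f 2 ∨ (a : EReal) = hs f 3 := by
  by_contra hcon
  push Not at hcon
  obtain ⟨n1, n2, n3⟩ := hcon
  apply h
  by_cases o0 : OM {x | f x ≤ a} 0
  · obtain ⟨g, -, hg⟩ := o0
    have he : ∀ x, ¬ f x ≤ a := fun x hx => by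
      obtain ⟨x, rfl⟩ := pr_surj x
      exact hg x hx (Subsingleton.elim _ _)
    exact ⟨⟨fun p => p.1, by fun_prop⟩, fun x => rfl, fun x => absurd x.2 (he _)⟩
  have l1 : hs f 1 < (a : EReal) := lt_of_le_of_ne ((hs_le_iff hf 0 a).2 o0) n1.symm
  obtain ⟨A, -, hA, hAf⟩ := exists_of_hs_lt l1
  obtain ⟨y, hy⟩ : A.Nonempty := by
    by_contra hcon
    rw [Set.not_nonempty_iff_eq_empty] at hcon
    exact hA ⟨0, fun x => by simp, fun x hx => by simp [hcon] at hx⟩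
  by_cases o1 : OM {x | f x ≤ a} 1
  · obtain ⟨H, H0, H1⟩ := bringsTo_point o1 y
    exact ⟨H, H0, fun x => by rw [show H (x, 1) = y from H1 x]; exact hAf hy⟩
  have l2 : hs f 2 < (a : EReal) := lt_of_le_of_ne ((hs_le_iff hf 1 a).2 o1) n2.symm
  obtain ⟨A, hAc, hA, hAf⟩ := exists_of_hs_lt l2
  by_cases hu : {x | f x ≤ a} = univ
  · have o2 : ¬ OM {x | f x ≤ a} 2 := by rw [hu]; exact not_OM_univ
    have l3 : hs f 3 < (a : EReal) := lt_of_le_of_ne ((hs_le_iff hf 2 a).2 o2) n3.symm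
    obtain ⟨A, -, hA, hAf⟩ := exists_of_hs_lt l3
    have hAu : A = univ := by
      by_contra hcon
      exact hA (OM_two_of_ne_univ hcon)
    exact ⟨⟨fun p => p.1, by fun_prop⟩, fun x => rfl, fun x => hAf (by rw [hAu]; trivial)⟩
  · exact bringsTo_of_loop hu (isOpen_lt hf continuous_const) hAc hA hAf

/-- For a continuous function on `ℝP²`, the homotopy significant spectrum is exactly
`{hs₁, hs₂, hs₃}`. -/
theorem homotopySignificant_spectrum_rp2
    (f : Proj (EuclideanSpace ℝ (Fin 3)) → ℝ) (hf : Continuous f) :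
    {a : ℝ | HomotopySignificant f a} =
      {a : ℝ | (a : EReal) = hs f 1 ∨ (a : EReal) = hs f 2 ∨ (a : EReal) = hs f 3} := by
  ext a
  refine ⟨fun h => eq_of_significant hf a h, ?_⟩
  rintro (h | h | h)
  · exact significant_of_eq hf 0 a h
  · exact significant_of_eq hf 1 a h
  · exact significant_of_eq hf 2 a h

end
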